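/- Let K, L ⊆ ℝⁿ be convex bodies with centroid at the origin whose Binet–Legendre ellipsoids are both the closed Euclidean unit ball Bⁿ, i.e. ((n+2)/vol(K))∫_K φ(y)² dy = ‖φ‖² = ((n+2)/vol(L))∫_L φ(y)² dy for every linear functional φ. If ε > 0 and K ⊆ L + ε·Bⁿ and L ⊆ K + ε·Bⁿ (i.e. the Euclidean Hausdorff distance between K and L is at most ε), then K ⊆ (1 + ε/a_n)·L and L ⊆ (1 + ε/a_n)·K, where a_n = 2^{-n/2-1}·n^{-3n/4-3/2}. -/

import Mathlib

open Set Metric Pointwise MeasureTheory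

/-- The centroid (center of mass) of a set `K ⊆ ℝⁿ`. -/
noncomputable def centroid {n : ℕ} (K : Set (EuclideanSpace ℝ (Fin n))) :
    EuclideanSpace ℝ (Fin n) :=
  (volume K).toReal⁻¹ • ∫ x in K, x

/-- The Binet–Legendre ellipsoid of `K` is the Euclidean unit ball, expressed via the
defining inner product on linear functionals. -/
def isBLUnitBall {n : ℕ} (K : Set (EuclideanSpace ℝ (Fin n))) : Prop :=
  ∀ φ : EuclideanSpace ℝ (Fin n) →L[ℝ] ℝ,
    ((n : ℝ) + 2) / (volume K).toReal * ∫ y in K, (φ y) ^ 2 = ‖φ‖ ^ 2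

/-- `aConst n = 2^(-n/2-1) * n^(-3n/4-3/2)`. -/
noncomputable def aConst (n : ℕ) : ℝ :=
  (2 : ℝ) ^ (-(n : ℝ) / 2 - 1) * (n : ℝ) ^ (-(3 * (n : ℝ)) / 4 - 3 / 2)

/-- Contracting a convex set towards one of its points stays inside the set, so the integral of a
nonnegative function dominates the integral of its contracted version. -/
theorem pow_mul_setIntegral_comp_homothety_le {n : ℕ} {K : Set (EuclideanSpace ℝ (Fin n))}
    (hcomp : IsCompact K) (hconv : Convex ℝ K) {x : EuclideanSpace ℝ (Fin n)} (hx : x ∈ K)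
    {g : EuclideanSpace ℝ (Fin n) → ℝ} (hg : Continuous g) (hg0 : ∀ y ∈ K, 0 ≤ g y)
    {s : ℝ} (hs0 : 0 < s) (hs1 : s ≤ 1) :
    s ^ n * ∫ y in K, g ((1 - s) • x + s • y) ≤ ∫ y in K, g y := by
  have h1 := Measure.setIntegral_comp_smul_of_pos (volume : Measure (EuclideanSpace ℝ (Fin n)))
    (fun z => g ((1 - s) • x + z)) K hs0
  rw [finrank_euclideanSpace_fin, smul_eq_mul] at h1
  rw [h1, mul_inv_cancel_left₀ (by positivity)]
  have h2 := (measurePreserving_add_left (volume : Measure (EuclideanSpace ℝ (Fin n)))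
    ((1 - s) • x)).setIntegral_image_emb (measurableEmbedding_addLeft _) g (s • K)
  rw [← h2]
  refine setIntegral_mono_set (hg.continuousOn.integrableOn_compact hcomp)
    ((ae_restrict_iff' hcomp.measurableSet).2 (Filter.Eventually.of_forall hg0))
    (LE.le.eventuallyLE ?_)
  rintro _ ⟨_, ⟨y, hy, rfl⟩, rfl⟩
  exact hconv hx hy (by linarith) hs0.le (by ring)

theorem setIntegral_clm_eq_zero {n : ℕ} {K : Set (EuclideanSpace ℝ (Fin n))}
    (hcomp : IsCompact K) (hV : 0 < (volume K).toReal) (hcent : centroid K = 0)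
    (φ : EuclideanSpace ℝ (Fin n) →L[ℝ] ℝ) : ∫ y in K, φ y = 0 := by
  have h0 : ∫ y in K, y = 0 := (smul_eq_zero.1 hcent).resolve_left (inv_ne_zero hV.ne')
  have hid : IntegrableOn (fun y : EuclideanSpace ℝ (Fin n) => y) K :=
    continuous_id.continuousOn.integrableOn_compact hcomp
  rw [φ.integral_comp_comm hid, h0, map_zero]

/-- The centroid divides the width in every direction in a ratio of at most `n`. -/
theorem neg_le_mul_of_centroid_eq_zero {n : ℕ} {K : Set (EuclideanSpace ℝ (Fin n))}
    (hcomp : IsCompact K) (hconv : Convex ℝ K) (hV : 0 < (volume K).toReal)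
    (hcent : centroid K = 0) (φ : EuclideanSpace ℝ (Fin n) →L[ℝ] ℝ) {h : ℝ}
    (hh : ∀ y ∈ K, φ y ≤ h) {x : EuclideanSpace ℝ (Fin n)} (hx : x ∈ K) :
    -φ x ≤ n * h := by
  have hi : IntegrableOn φ K := φ.continuous.continuousOn.integrableOn_compact hcomp
  have hc : ∀ c : ℝ, IntegrableOn (fun _ => c) K volume := fun c =>
    continuousOn_const.integrableOn_compact hcomp
  have hφ := setIntegral_clm_eq_zero hcomp hV hcent φ
  have key : ∀ s ∈ Set.Ioo (0 : ℝ) 1,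
      s ^ n * -φ x ≤ (∑ i ∈ Finset.range n, s ^ i) * h := by
    intro s hs
    have h1 := pow_mul_setIntegral_comp_homothety_le hcomp hconv hx
      (g := fun y => h - φ y) (by fun_prop) (fun y hy => by linarith [hh y hy]) hs.1 hs.2.le
    have e1 : ∫ y in K, (h - φ y) = (volume K).toReal * h := by
      rw [integral_sub (hc h) hi, hφ, setIntegral_const, smul_eq_mul, sub_zero]; rfl
    have e2 : ∫ y in K, (h - φ ((1 - s) • x + s • y)) =
        (volume K).toReal * (h - (1 - s) * φ x) := by
      have : ∀ y, h - φ ((1 - s) • x + s • y) = (h - (1 - s) * φ x) - s * φ y := by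
        intro y; simp only [map_add, map_smul, smul_eq_mul]; ring
      simp_rw [this]
      rw [integral_sub (hc _) (hi.const_mul s), integral_const_mul, hφ, setIntegral_const,
        smul_eq_mul, mul_zero, sub_zero]; rfl
    rw [e1, e2] at h1
    have h2 : s ^ n * (h - (1 - s) * φ x) ≤ h := by
      refine le_of_mul_le_mul_left ?_ hV
      linarith
    have h3 := mul_neg_geom_sum s n
    have h4 : 0 < 1 - s := by linarith [hs.2]
    refine le_of_mul_le_mul_left ?_ h4
    rw [← mul_assoc (1 - s) _ h, h3]
    linarith
  have hmem : ∀ᶠ s in nhdsWithin (1 : ℝ) (Set.Iio 1), s ∈ Set.Ioo (0 : ℝ) 1 :=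
    Ioo_mem_nhdsLT one_pos
  have t1 : Filter.Tendsto (fun s : ℝ => s ^ n * -φ x) (nhdsWithin 1 (Set.Iio 1))
      (nhds (1 ^ n * -φ x)) :=
    ((by fun_prop : Continuous fun s : ℝ => s ^ n * -φ x).tendsto 1).mono_left
      nhdsWithin_le_nhds
  have t2 : Filter.Tendsto (fun s : ℝ => (∑ i ∈ Finset.range n, s ^ i) * h)
      (nhdsWithin 1 (Set.Iio 1)) (nhds ((∑ i ∈ Finset.range n, (1 : ℝ) ^ i) * h)) :=
    ((by fun_prop : Continuous fun s : ℝ => (∑ i ∈ Finset.range n, s ^ i) * h).tendsto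
      1).mono_left nhdsWithin_le_nhds
  have := le_of_tendsto_of_tendsto t1 t2 (hmem.mono key)
  simpa using this

theorem toReal_volume_pos {n : ℕ} {K : Set (EuclideanSpace ℝ (Fin n))}
    (hcomp : IsCompact K) (hint : (interior K).Nonempty) : 0 < (volume K).toReal :=
  ENNReal.toReal_pos (Measure.measure_pos_of_nonempty_interior volume hint).ne'
    hcomp.measure_lt_top.ne

/-- A lower bound for the support function of a centred body in Binet–Legendre position. -/
theorem sq_norm_le_of_isBLUnitBall {n : ℕ} {K : Set (EuclideanSpace ℝ (Fin n))}
    (hcomp : IsCompact K) (hconv : Convex ℝ K) (hint : (interior K).Nonempty)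
    (hcent : centroid K = 0) (hBL : isBLUnitBall K) (φ : EuclideanSpace ℝ (Fin n) →L[ℝ] ℝ)
    {h : ℝ} (hh : ∀ y ∈ K, φ y ≤ h) : ‖φ‖ ^ 2 ≤ n * (n + 2) * h ^ 2 := by
  have hV := toReal_volume_pos hcomp hint
  have hφ := setIntegral_clm_eq_zero hcomp hV hcent φ
  have hint_cont : ∀ g : EuclideanSpace ℝ (Fin n) → ℝ, Continuous g → IntegrableOn g K :=
    fun g hg => hg.continuousOn.integrableOn_compact hcomp
  have h1 : 0 ≤ ∫ y in K, (h - φ y) * (φ y + n * h) := by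
    refine setIntegral_nonneg hcomp.measurableSet fun y hy => mul_nonneg ?_ ?_
    · linarith [hh y hy]
    · linarith [neg_le_mul_of_centroid_eq_zero hcomp hconv hV hcent φ hh hy]
  have e : ∀ y, (h - φ y) * (φ y + n * h) = (n * h ^ 2 + (h - n * h) * φ y) - φ y ^ 2 := by
    intro y; ring
  simp_rw [e] at h1
  rw [integral_sub (hint_cont _ (by fun_prop)) (hint_cont _ (by fun_prop)),
    integral_add (hint_cont _ (by fun_prop)) (hint_cont _ (by fun_prop)),
    integral_const_mul (h - n * h), hφ, setIntegral_const, smul_eq_mul, mul_zero,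
    add_zero] at h1
  change 0 ≤ (volume K).toReal * _ - _ at h1
  rw [← hBL φ, div_mul_eq_mul_div, div_le_iff₀ hV]
  have : ((n : ℝ) + 2) * ∫ y in K, φ y ^ 2 ≤ (n + 2) * ((volume K).toReal * (n * h ^ 2)) :=
    mul_le_mul_of_nonneg_left (by linarith) (by positivity)
  linarith

theorem aConst_pos {n : ℕ} (hn : 1 ≤ n) : 0 < aConst n := by
  have : (0 : ℝ) < n := by exact_mod_cast hn
  unfold aConst
  positivity

theorem mul_mul_aConst_sq_le_one {n : ℕ} (hn : 1 ≤ n) :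
    (n : ℝ) * (n + 2) * aConst n ^ 2 ≤ 1 := by
  have hn1 : (1 : ℝ) ≤ n := by exact_mod_cast hn
  have h2 : (2 : ℝ) ^ (-(n : ℝ) / 2 - 1) ≤ 2 ^ (-1 : ℝ) :=
    Real.rpow_le_rpow_of_exponent_le (by norm_num) (by linarith)
  have h3 : (n : ℝ) ^ (-(3 * (n : ℝ)) / 4 - 3 / 2) ≤ (n : ℝ) ^ (-1 : ℝ) :=
    Real.rpow_le_rpow_of_exponent_le hn1 (by linarith)
  rw [Real.rpow_neg_one] at h2 h3
  have h4 : aConst n ≤ 2⁻¹ * (n : ℝ)⁻¹ := by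
    unfold aConst
    gcongr
  have h5 : aConst n ^ 2 ≤ (2⁻¹ * (n : ℝ)⁻¹) ^ 2 :=
    pow_le_pow_left₀ (aConst_pos hn).le h4 2
  calc (n : ℝ) * (n + 2) * aConst n ^ 2 ≤ n * (n + 2) * (2⁻¹ * (n : ℝ)⁻¹) ^ 2 := by gcongr
    _ ≤ 1 := by
      field_simp
      linarith

theorem closedBall_aConst_subset {n : ℕ} (hn : 1 ≤ n) {K : Set (EuclideanSpace ℝ (Fin n))}
    (hcomp : IsCompact K) (hconv : Convex ℝ K) (hint : (interior K).Nonempty)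
    (hcent : centroid K = 0) (hBL : isBLUnitBall K) :
    closedBall (0 : EuclideanSpace ℝ (Fin n)) (aConst n) ⊆ K := by
  intro x hx
  by_contra hxK
  obtain ⟨φ, u, hu, hux⟩ := geometric_hahn_banach_closed_point hconv hcomp.isClosed hxK
  obtain ⟨y, hy, hmax⟩ := hcomp.exists_isMaxOn (hint.mono interior_subset)
    φ.continuous.continuousOn
  have h1 := sq_norm_le_of_isBLUnitBall hcomp hconv hint hcent hBL φ (h := φ y) hmax
  have hV := toReal_volume_pos hcomp hint
  have h0 : 0 ≤ φ y := by
    have := setIntegral_mono_on (μ := volume) (φ.continuous.continuousOn.integrableOn_compact hcomp)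
      (continuousOn_const.integrableOn_compact hcomp) hcomp.measurableSet
      (g := fun _ => φ y) hmax
    rw [setIntegral_clm_eq_zero hcomp hV hcent φ, setIntegral_const, smul_eq_mul] at this
    exact nonneg_of_mul_nonneg_right this hV
  rw [mem_closedBall_zero_iff] at hx
  have h2 : φ y < ‖φ‖ * aConst n :=
    calc φ y < φ x := (hu y hy).trans hux
      _ ≤ ‖φ‖ * ‖x‖ := (le_abs_self _).trans (φ.le_opNorm x)
      _ ≤ ‖φ‖ * aConst n := by gcongr
  have h3 : φ y ^ 2 < (‖φ‖ * aConst n) ^ 2 := pow_lt_pow_left₀ h2 h0 two_ne_zero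
  have hn0 : (0 : ℝ) < n := by exact_mod_cast hn
  have h4 : (n : ℝ) * (n + 2) * φ y ^ 2 < n * (n + 2) * (‖φ‖ * aConst n) ^ 2 := by gcongr
  have h5 : ‖φ‖ ^ 2 * ((n : ℝ) * (n + 2) * aConst n ^ 2) ≤ ‖φ‖ ^ 2 * 1 :=
    mul_le_mul_of_nonneg_left (mul_mul_aConst_sq_le_one hn) (by positivity)
  nlinarith

theorem add_smul_closedBall_subset {E : Type*} [NormedAddCommGroup E] [NormedSpace ℝ E]
    {L : Set E} (hconv : Convex ℝ L) {a ε : ℝ} (ha : 0 < a) (hε : 0 ≤ ε)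
    (hball : closedBall (0 : E) a ⊆ L) :
    L + ε • closedBall (0 : E) 1 ⊆ (1 + ε / a) • L := by
  have hsub : ε • closedBall (0 : E) 1 ⊆ (ε / a) • L := by
    have : closedBall (0 : E) a = a • closedBall (0 : E) 1 := by
      rw [smul_unitClosedBall_of_nonneg ha.le]
    calc ε • closedBall (0 : E) 1 = (ε / a) • closedBall (0 : E) a := by
          rw [this, smul_smul, div_mul_cancel₀ _ ha.ne']
      _ ⊆ (ε / a) • L := smul_set_mono hball
  rw [hconv.add_smul zero_le_one (by positivity), one_smul]
  exact add_subset_add_left hsub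

theorem stmt6 {n : ℕ} (K L : Set (EuclideanSpace ℝ (Fin n)))
    (hKcomp : IsCompact K) (hKconv : Convex ℝ K) (hKint : (interior K).Nonempty)
    (hLcomp : IsCompact L) (hLconv : Convex ℝ L) (hLint : (interior L).Nonempty)
    (hKcent : centroid K = 0) (hLcent : centroid L = 0)
    (hKBL : isBLUnitBall K) (hLBL : isBLUnitBall L)
    (ε : ℝ) (hε : 0 < ε)
    (h₁ : K ⊆ L + ε • closedBall (0 : EuclideanSpace ℝ (Fin n)) 1)
    (h₂ : L ⊆ K + ε • closedBall (0 : EuclideanSpace ℝ (Fin n)) 1) :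
    K ⊆ (1 + ε / aConst n) • L ∧ L ⊆ (1 + ε / aConst n) • K := by
  rcases Nat.eq_zero_or_pos n with rfl | hn
  · have hK := (subsingleton_of_subsingleton (s := K)).eq_singleton_of_mem
      (hKint.mono interior_subset).some_mem
    have hL := (subsingleton_of_subsingleton (s := L)).eq_singleton_of_mem
      (hLint.mono interior_subset).some_mem
    rw [hK, hL]
    simp only [smul_set_singleton, singleton_subset_iff, mem_singleton_iff]
    exact ⟨Subsingleton.elim _ _, Subsingleton.elim _ _⟩
  · exact ⟨h₁.trans (add_smul_closedBall_subset hLconv (aConst_pos hn) hε.le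
        (closedBall_aConst_subset hn hLcomp hLconv hLint hLcent hLBL)),
      h₂.trans (add_smul_closedBall_subset hKconv (aConst_pos hn) hε.le
        (closedBall_aConst_subset hn hKcomp hKconv hKint hKcent hKBL))⟩
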